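/- (Lemma 2 / hidden-layer part of Theorem 2.) Under the Weight Maximization with direct gradient update, for every l ∈ {1,…,L−1}, the update satisfies the closed form ΔW^l = 2·4^{L−l} · R(X,A) · A · (1 − π_{W^L}(H^{L−1},A)) · (H^{l−1})ᵀ (D^l M^{l+1} M^{l+2} ⋯ M^{L−1} W^L)ᵀ, where π_{W^L}(h,a) = σ(a · hW^L), D^l is the m^l×m^l diagonal matrix with j-th diagonal entry σ'((H^{l−1}W^l)_j), and for each k, M^k ∈ ℝ^{m^{k−1}×m^k} has entries M^k_{ij} = W^k_{ij} σ'((H^{k−1}W^k)_j), with σ'(z) = σ(z)(1−σ(z)). -/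

import Mathlib

/-- The logistic sigmoid `σ(z) = 1/(1+exp(−z))`. -/
noncomputable def sig (z : ℝ) : ℝ := 1 / (1 + Real.exp (-z))

/-- `σ'(z) = σ(z)(1−σ(z))`. -/
noncomputable def sigp (z : ℝ) : ℝ := sig z * (1 - sig z)

/-- The values of all layers of a multi-layer network with `L = n+1` layers (besides the
input layer): layer `0` is the state `x`, and layer `t+1` is the hidden/output value
`g t ∈ {−1,+1}^{m (t+1)}`. -/
def Vof (n : ℕ) (m : ℕ → ℕ) (x : Fin (m 0) → ℝ)
    (g : (t : Fin (n + 1)) → Fin (m (t.1 + 1)) → ℝ) : (l : ℕ) → Fin (m l) → ℝ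
  | 0 => x
  | (t + 1) => if ht : t < n + 1 then g ⟨t, ht⟩ else fun _ => 1

/-- All assignments of values in `{−1,+1}` to the units of layers `1, …, n+1`. -/
noncomputable def hiddenSet (n : ℕ) (m : ℕ → ℕ) :
    Finset ((t : Fin (n + 1)) → Fin (m (t.1 + 1)) → ℝ) :=
  Fintype.piFinset fun _ => Fintype.piFinset fun _ => ({-1, 1} : Finset ℝ)

/-- Probability `∏_{l=1}^{L} π_l(H^{l−1}, H^l; W^l)` of the layer values `g` given the
state `x`, where `π_l(h^{l−1},h^l;W^l) = ∏_i σ(h^l_i · (h^{l−1}W^l)_i)`. -/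
noncomputable def Pg (n : ℕ) (m : ℕ → ℕ)
    (W : (t : ℕ) → Matrix (Fin (m t)) (Fin (m (t + 1))) ℝ)
    (x : Fin (m 0) → ℝ) (g : (t : Fin (n + 1)) → Fin (m (t.1 + 1)) → ℝ) : ℝ :=
  ∏ t : Fin (n + 1), ∏ i,
    sig (Vof n m x g (t.1 + 1) i * ∑ j, Vof n m x g t.1 j * W t.1 j i)

/-- The expected reward `J(W) = E[R(X,A) | π_W]` of the multi-layer network. -/
noncomputable def Jnet (n : ℕ) (m : ℕ → ℕ)
    (W : (t : ℕ) → Matrix (Fin (m t)) (Fin (m (t + 1))) ℝ)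
    (X : Finset (Fin (m 0) → ℝ)) (d0 : (Fin (m 0) → ℝ) → ℝ)
    (R : (Fin (m 0) → ℝ) → (Fin (m (n + 1)) → ℝ) → ℝ) : ℝ :=
  ∑ x ∈ X, ∑ g ∈ hiddenSet n m, d0 x * Pg n m W x g * R x (Vof n m x g (n + 1))

/-- The matrix `W^t` with its `(i,j)` entry replaced by `s`. -/
def updEntry {a b : Type*} [DecidableEq a] [DecidableEq b]
    (M : Matrix a b ℝ) (i : a) (j : b) (s : ℝ) : Matrix a b ℝ :=
  Matrix.of fun p q => if p = i ∧ q = j then s else M p q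

/-- The Weight Maximization with direct gradient update for the transition `t` (from
layer `t` into layer `t+1`), for the realization `V` of all layer values and reward `r`:
`ΔW^L = (H^{L−1})ᵀ R (A − E[A|H^{L−1}])`, and for hidden transitions
`ΔW^l = (H^{l−1})ᵀ (2 R^l ⊙ H^l ⊙ σ'(H^{l−1}W^l))` with
`R^l = (2(ΔW^{l+1} ⊙ W^{l+1})𝟙)ᵀ`. Here the output transition is `t = n` (so `L = n+1`). -/
noncomputable def dWdg (n : ℕ) (m : ℕ → ℕ)
    (W : (t : ℕ) → Matrix (Fin (m t)) (Fin (m (t + 1))) ℝ)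
    (V : (l : ℕ) → Fin (m l) → ℝ) (r : ℝ) (t : ℕ) :
    Matrix (Fin (m t)) (Fin (m (t + 1))) ℝ :=
  if t = n then
    Matrix.of fun i j =>
      V t i * (r * (V (t + 1) j - (2 * sig (∑ k, V t k * W t k j) - 1)))
  else if ht : t < n then
    Matrix.of fun i j =>
      V t i * (2 * (2 * ∑ k, dWdg n m W V r (t + 1) j k * W (t + 1) j k) *
        V (t + 1) j * sigp (∑ k, V t k * W t k j))
  else 0
termination_by n - t
decreasing_by omega

/-- The matrix product `(I ⊙ 𝟙σ'(H^{l−1}W^l)) (W^{l+1} ⊙ 𝟙σ'(H^l W^{l+1})) ⋯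
(W^{l+k} ⊙ 𝟙σ'(H^{l+k−1}W^{l+k}))` with `l = t+1`, where the first factor is diagonal
with entries `σ'((H^{l−1}W^l)_j)` and `(W^s ⊙ 𝟙σ'(H^{s−1}W^s))_{ij} = W^s_{ij}
σ'((H^{s−1}W^s)_j)`. -/
noncomputable def chainD (n : ℕ) (m : ℕ → ℕ)
    (W : (t : ℕ) → Matrix (Fin (m t)) (Fin (m (t + 1))) ℝ)
    (V : (l : ℕ) → Fin (m l) → ℝ) (t : ℕ) :
    (k : ℕ) → Matrix (Fin (m (t + 1))) (Fin (m (t + 1 + k))) ℝ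
  | 0 => Matrix.of fun i j =>
      if i = j then sigp (∑ p, V t p * W t p i) else 0
  | (k + 1) => chainD n m W V t k *
      Matrix.of (fun i j => W (t + 1 + k) i j * sigp (∑ p, V (t + 1 + k) p * W (t + 1 + k) p j))

/-- Backward-propagated vector `M^{l+1} ⋯ M^{L-1} W^L 𝟙`. -/
noncomputable def backU (n : ℕ) (m : ℕ → ℕ)
    (W : (t : ℕ) → Matrix (Fin (m t)) (Fin (m (t + 1))) ℝ)
    (V : (l : ℕ) → Fin (m l) → ℝ) (l : ℕ) : Fin (m l) → ℝ :=
  if l < n then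
    fun i => ∑ k, (W l i k * sigp (∑ p, V l p * W l p k)) * backU n m W V (l + 1) k
  else fun i => ∑ b, W l i b
termination_by n - l
decreasing_by omega

theorem chainD_backU (n : ℕ) (m : ℕ → ℕ)
    (W : (t : ℕ) → Matrix (Fin (m t)) (Fin (m (t + 1))) ℝ)
    (V : (l : ℕ) → Fin (m l) → ℝ) (t k : ℕ) (h : t + 1 + k ≤ n) (j : Fin (m (t + 1))) :
    ∑ c, chainD n m W V t k j c * backU n m W V (t + 1 + k) c
      = sigp (∑ p, V t p * W t p j) * backU n m W V (t + 1) j := by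
  induction k with
  | zero => simp [chainD]
  | succ k ih =>
    rw [← ih (by omega)]
    have e : ∀ c, backU n m W V (t + 1 + k) c = ∑ d,
        (W (t + 1 + k) c d * sigp (∑ p, V (t + 1 + k) p * W (t + 1 + k) p d)) *
          backU n m W V (t + 1 + k + 1) d := by
      intro c
      rw [backU, if_pos (by omega)]
    simp only [e, chainD, Matrix.mul_apply, Matrix.of_apply, Finset.sum_mul, Finset.mul_sum]
    refine Finset.sum_comm.trans ?_
    refine Finset.sum_congr rfl fun c _ => Finset.sum_congr rfl fun d _ => ?_
    rw [mul_assoc]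
    rfl

theorem backU_cast (n : ℕ) (m : ℕ → ℕ)
    (W : (t : ℕ) → Matrix (Fin (m t)) (Fin (m (t + 1))) ℝ)
    (V : (l : ℕ) → Fin (m l) → ℝ) (l : ℕ) (h : l = n) (c : Fin (m l)) :
    ∑ b, W n (Fin.cast (congrArg m h) c) b = backU n m W V l c := by
  subst h
  rw [backU, if_neg (lt_irrefl _)]
  rfl

theorem sig_neg' (z : ℝ) : sig (-z) = 1 - sig z := by
  unfold sig
  have h1 := Real.exp_pos z
  have h2 := Real.exp_pos (-z)
  have h3 : Real.exp z * Real.exp (-z) = 1 := by rw [← Real.exp_add]; simp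
  rw [neg_neg]
  field_simp
  linarith

theorem dW_closed (n : ℕ) (m : ℕ → ℕ) (hmL : m (n + 1) = 1)
    (W : (t : ℕ) → Matrix (Fin (m t)) (Fin (m (t + 1))) ℝ)
    (V : (l : ℕ) → Fin (m l) → ℝ)
    (hV : ∀ l, 1 ≤ l → l ≤ n + 1 → ∀ i, V l i = 1 ∨ V l i = -1)
    (r : ℝ) (a : Fin (m (n + 1))) (k : ℕ) : ∀ (t : ℕ) (_ : t + 1 + k = n) (i : Fin (m t))
    (j : Fin (m (t + 1))),
    dWdg n m W V r t i j
      = 2 * 4 ^ (k + 1) * r * V (n + 1) a *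
          (1 - sig (V (n + 1) a * ∑ p, V n p * W n p a)) *
          (V t i * (sigp (∑ p, V t p * W t p j) * backU n m W V (t + 1) j)) := by
  induction k with
  | zero =>
    intro t h i j
    obtain rfl : n = t + 1 := by omega
    have hs : Subsingleton (Fin (m (t + 1 + 1))) := by rw [hmL]; infer_instance
    have hsum : ∀ f : Fin (m (t + 1 + 1)) → ℝ, ∑ k, f k = f a := fun f =>
      Fintype.sum_eq_single a fun x hx => absurd (Subsingleton.elim x a) hx
    rw [dWdg, if_neg (by omega), dif_pos (by omega), dWdg, if_pos rfl, backU,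
      if_neg (lt_irrefl _)]
    simp only [Matrix.of_apply, hsum]
    have hj := hV (t + 1) (by omega) (by omega) j
    rcases hV (t + 1 + 1) (by omega) (by omega) a with ha | ha <;>
    rcases hj with hj | hj <;> rw [ha, hj] <;>
    simp only [one_mul, neg_one_mul, sig_neg'] <;> ring
  | succ k ih =>
    intro t h i j
    rw [dWdg, if_neg (by omega), dif_pos (by omega), backU, if_pos (by omega)]
    simp only [Matrix.of_apply]
    simp only [ih (t + 1) (by omega)]
    have hj : V (t + 1) j * V (t + 1) j = 1 := by
      rcases hV (t + 1) (by omega) (by omega) j with hj | hj <;> rw [hj] <;> norm_num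
    generalize 1 - sig (V (n + 1) a * ∑ p, V n p * W n p a) = C
    have e : ∑ x, 2 * 4 ^ (k + 1) * r * V (n + 1) a * C *
          (V (t + 1) j * (sigp (∑ p, V (t + 1) p * W (t + 1) p x) *
            backU n m W V (t + 1 + 1) x)) * W (t + 1) j x =
        2 * 4 ^ (k + 1) * r * V (n + 1) a * C * V (t + 1) j *
        ∑ x, W (t + 1) j x * sigp (∑ p, V (t + 1) p * W (t + 1) p x) *
            backU n m W V (t + 1 + 1) x := by
      rw [Finset.mul_sum]
      exact Finset.sum_congr rfl fun x _ => by ring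
    rw [e]
    generalize (∑ x, W (t + 1) j x * sigp (∑ p, V (t + 1) p * W (t + 1) p x) *
            backU n m W V (t + 1 + 1) x) = S
    linear_combination (4 * V t i * sigp (∑ p, V t p * W t p j) *
      (2 * 4 ^ (k + 1) * r * V (n + 1) a * C) * S) * hj

/-- Lemma 2 (hidden-layer part of Theorem 2): for every hidden transition `t < n`
(layer `l = t+1 ∈ {1,…,L−1}`, `L = n+1`), the Weight Maximization with direct gradient
update satisfies the closed form
`ΔW^l = 2·4^{L−l} R A (1 − π_{W^L}(H^{L−1},A)) (H^{l−1})ᵀ (D^l M^{l+1} ⋯ M^{L−1} W^L)ᵀ`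
(entrywise; `A = V (n+1) a` is the action, the sums over `c, b` range over the
one-element row/column index sets of `W^L`, since `m^L = 1`). -/
theorem stmt10 (n : ℕ) (m : ℕ → ℕ) (hmL : m (n + 1) = 1)
    (W : (t : ℕ) → Matrix (Fin (m t)) (Fin (m (t + 1))) ℝ)
    (V : (l : ℕ) → Fin (m l) → ℝ)
    (hV : ∀ l, 1 ≤ l → l ≤ n + 1 → ∀ i, V l i = 1 ∨ V l i = -1)
    (r : ℝ) (t : ℕ) (ht : t < n) (i : Fin (m t)) (j : Fin (m (t + 1)))
    (a : Fin (m (n + 1))) :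
    dWdg n m W V r t i j
      = 2 * 4 ^ (n - t) * r * V (n + 1) a *
          (1 - sig (V (n + 1) a * ∑ p, V n p * W n p a)) *
          (V t i * ∑ c : Fin (m (t + 1 + (n - 1 - t))), ∑ b : Fin (m (n + 1)),
            chainD n m W V t (n - 1 - t) j c *
              W n (Fin.cast (congrArg m (by omega : t + 1 + (n - 1 - t) = n)) c) b) := by
  rw [dW_closed n m hmL W V hV r a (n - 1 - t) t (by omega) i j,
    ← chainD_backU n m W V t (n - 1 - t) (by omega) j,
    show n - 1 - t + 1 = n - t by omega]
  simp only [← Finset.mul_sum, backU_cast n m W V _ (by omega : t + 1 + (n - 1 - t) = n)]
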